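/- arXiv:1304.3029 — 2 statements merged into one kernel-verified Lean document; each statement's English description precedes it below -/
import Mathlib

section
/- Let (λ_0,λ_1,λ_2,λ_3,λ_4) be a well-formed tuple of positive integers with gcd equal to 1 and h = λ_0 + ⋯ + λ_4, such that for every integer κ with 2 ≤ κ ≤ h − 2 one has 1 ≤ Σ_{i=0}^4 {λ_i κ / h} ≤ 3 (i.e. ℙ(λ_0,…,λ_4) has at worst canonical singularities). Then h ≤ 3486, and if h = 3486 then, up to permutation, (λ_0,…,λ_4) = (41, 42, 498, 1162, 1743). -/
theorem mul_sub_le_mul_mul {x y z r b : ℝ} (hx : 0 < x) (hyz : z ≤ y)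
    (hsum : x + y + z + r = 1) (hxy : x * y ≤ z + r) (hb : b * (1 + x) = 1 - x) :
    x * b * (x * b - r) ≤ x * y * z := by
  have hyb : y ≤ b := by
    have : y * (1 + x) ≤ b * (1 + x) := by rw [hb]; linarith
    exact le_of_mul_le_mul_right this (by linarith)
  have hp : 0 ≤ (b - y) * (b - z) := mul_nonneg (by linarith) (by linarith)
  have hyz' : b * (x * b - r) ≤ y * z := by
    have e1 : x * b = 1 - x - b := by linarith
    have e2 : y = 1 - x - z - r := by linarith
    rw [e1]; subst e2; nlinarith
  calc x * b * (x * b - r) = x * (b * (x * b - r)) := by ring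
    _ ≤ x * (y * z) := by gcongr
    _ = _ := by ring

theorem linear_le_mul_mul {x y z r : ℝ} (hz : 0 < z) (hr : 0 < r) (hyz : z ≤ y) (hxy' : y ≤ x)
    (hsum : x + y + z + r = 1) (hx2 : x ≤ 1 / 2) (hxy : x * y ≤ z + r) :
    1 / 36 - r / 6 ≤ x * y * z := by
  have hy : 0 < y := by linarith
  have hx : 0 < x := by linarith
  have hp : 0 < x * y * z := by positivity
  by_cases hr6 : 1 / 6 ≤ r
  · linarith
  push Not at hr6
  rcases le_or_gt (1 / 3) x with h3 | h3
  · have hb : (1 - x) / (1 + x) * (1 + x) = 1 - x := by field_simp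
    set b := (1 - x) / (1 + x)
    have h1 := mul_sub_le_mul_mul hx hyz hsum hxy hb
    have hu : 1 / 6 ≤ x * b := by
      have : 1 / 6 * (1 + x) ≤ x * b * (1 + x) := by
        rw [mul_assoc, hb]; nlinarith
      exact le_of_mul_le_mul_right this (by linarith)
    nlinarith
  · have h1 : 1 / 3 * (2 / 3 - r - x) ≤ y * z := by
      have : 0 ≤ (1 / 3 - y) * (1 / 3 - z) := mul_nonneg (by linarith) (by linarith)
      linarith
    have h2 : x * (1 / 3 * (2 / 3 - r - x)) ≤ x * (y * z) := by gcongr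
    have h4 : 0 ≤ (1 / 3 - x) * (x - (1 - r) / 3) := mul_nonneg (by linarith) (by linarith)
    nlinarith

theorem tail_lt {x y z w v : ℝ} (hv : 0 < v) (hwv : v ≤ w) (hzw : w ≤ z) (hyz : z ≤ y)
    (hxy' : y ≤ x) (hsum : x + y + z + (w + v) = 1) (hx2 : x ≤ 1 / 2)
    (hxy : x * y ≤ z + (w + v)) (hp : x * y * z * w ≤ 1 / 3486) : w + v < 0.0242 := by
  have hw : 0 < w := by linarith
  have hz : 0 < z := by linarith
  have hy : 0 < y := by linarith
  have hx : 0 < x := by linarith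
  have hU := linear_le_mul_mul hz (add_pos hw hv) hyz hxy' hsum hx2 hxy
  have hP : (1 / 36 - (w + v) / 6) * w ≤ 1 / 3486 := by
    refine le_trans ?_ hp
    gcongr
  by_contra! hcon
  have hr : 0.142 < w + v := by
    by_contra! hr
    have : (1 / 36 - (w + v) / 6) * ((w + v) / 2) ≤ (1 / 36 - (w + v) / 6) * w := by
      apply mul_le_mul_of_nonneg_left <;> linarith
    nlinarith
  have hw' : 0.071 < w := by linarith
  have hxyz : x * y * z ≤ 0.00405 := by
    have : x * y * z * 0.071 ≤ x * y * z * w := by gcongr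
    linarith
  obtain ⟨s, hs⟩ : ∃ s, s = z + (w + v) := ⟨_, rfl⟩
  have hs1 : s / 3 ≤ z := by linarith
  have hs2 : 0.213 ≤ s := by linarith
  have hxyz' : x * y * (s / 3) ≤ 0.00405 := le_trans (by gcongr) hxyz
  rcases le_or_gt s (3 / 8) with h8 | h8
  · have h1 : 1 / 2 * (1 / 2 - s) ≤ x * y := by
      have : 0 ≤ (1 / 2 - x) * (1 / 2 - y) := mul_nonneg (by linarith) (by linarith)
      linarith
    have h2 : 1 / 2 * (1 / 2 - s) * (s / 3) ≤ x * y * (s / 3) := by gcongr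
    nlinarith
  · have h1 : s / 3 * (1 - 4 * s / 3) ≤ x * y := by
      have : 0 ≤ (x - s / 3) * (y - s / 3) := mul_nonneg (by linarith) (by linarith)
      have h5 : s * (x + y) = s * (1 - s) := by rw [hs, ← hsum]; ring
      linarith
    have h3 : s ≤ 3 / 5 := by linarith
    have h2 : s / 3 * (1 - 4 * s / 3) * (s / 3) ≤ x * y * (s / 3) := by gcongr
    have h4 : 0 ≤ s * (s - 3 / 8) * (3 / 5 - s) :=
      mul_nonneg (mul_nonneg (by linarith) (by linarith)) (by linarith)
    have h5 : 0 ≤ s * (3 / 5 - s) := mul_nonneg (by linarith) (by linarith)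
    have h6 := h2.trans hxyz'
    ring_nf at h4 h5 h6
    linarith

theorem lt_of_prod_le {x y z w v : ℝ} (hv : 0 < v) (hwv : v ≤ w) (hzw : w ≤ z) (hyz : z ≤ y)
    (hxy' : y ≤ x) (hsum : x + y + z + (w + v) = 1) (hx2 : x ≤ 1 / 2)
    (hxy : x * y ≤ z + (w + v)) (hxyz : x * y * z ≤ w + v) (hp : x * y * z * w ≤ 1 / 3486) :
    42 / 85 < x ∧ 28 / 85 < y ∧ 12 / 85 < z := by
  have hr := tail_lt hv hwv hzw hyz hxy' hsum hx2 hxy hp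
  have hw : 0 < w := by linarith
  have hz : 0 < z := by linarith
  have hy : 0 < y := by linarith
  have hx : 0 < x := by linarith
  have hU := linear_le_mul_mul hz (add_pos hw hv) hyz hxy' hsum hx2 hxy
  have hP : x * y * z * ((w + v) / 2) ≤ 1 / 3486 := by
    refine le_trans ?_ hp
    gcongr
    linarith
  obtain ⟨r, hrdef⟩ : ∃ r, r = w + v := ⟨_, rfl⟩
  obtain ⟨p, hpdef⟩ : ∃ p, p = x * y * z := ⟨_, rfl⟩
  rw [← hrdef] at hsum hxy hxyz hr hU hP
  rw [← hpdef] at hxyz hU hP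
  have hr42 : 1 / 42 ≤ r := by linarith
  have hp' : p ≤ 0.0241 := by nlinarith
  have hx1 : 42 / 85 < x := by
    by_contra! hcon
    have h4 : 2 / 5 < x := by
      by_contra! h4
      have h1 : 2 / 5 * (3 / 5 - r - x) ≤ y * z := by
        have : 0 ≤ (2 / 5 - y) * (2 / 5 - z) := mul_nonneg (by linarith) (by linarith)
        linarith
      have h2 : x * (2 / 5 * (3 / 5 - r - x)) ≤ x * (y * z) := by gcongr
      have h5 : 0 ≤ (2 / 5 - x) * (x - 0.325) := mul_nonneg (by linarith) (by linarith)
      have h6 : 0 ≤ x * (0.0242 - r) := mul_nonneg (by linarith) (by linarith)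
      linarith
    have hb : (1 - x) / (1 + x) * (1 + x) = 1 - x := by field_simp
    set b := (1 - x) / (1 + x)
    have h1 := mul_sub_le_mul_mul hx hyz hsum hxy hb
    have hu : 1806 / 10795 ≤ x * b := by
      have : 1806 / 10795 * (1 + x) ≤ x * b * (1 + x) := by
        have : 0 ≤ (42 / 85 - x) * (x - 43 / 127) := mul_nonneg (by linarith) (by linarith)
        rw [mul_assoc, hb]; linarith
      exact le_of_mul_le_mul_right this (by linarith)
    have h2 : (1806 / 10795 : ℝ) * (1806 / 10795 - r) ≤ p := by
      rw [hpdef]; refine le_trans ?_ h1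
      apply mul_le_mul <;> linarith
    have h3 : (0.023976 : ℝ) ≤ r := by linarith
    have h6 : (1806 / 10795 : ℝ) * (1806 / 10795 - r) * (r / 2) ≤ p * (r / 2) := by gcongr
    have h7 : 0 ≤ (r - 0.023976) * (0.0242 - r) := mul_nonneg (by linarith) (by linarith)
    linarith
  refine ⟨hx1, ?_, ?_⟩
  · by_contra! hcon
    have h1 : 28 / 85 * (1 - r - x - 28 / 85) ≤ y * z := by
      have : 0 ≤ (28 / 85 - y) * (28 / 85 - z) := mul_nonneg (by linarith) (by linarith)
      linarith
    have h2 : x * (28 / 85 * (1 - r - x - 28 / 85)) ≤ x * (y * z) := by gcongr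
    have h3 : 14 / 85 * (1 / 2 - 28 / 85 - r) ≤ p := by
      have : 0 ≤ (1 / 2 - x) * (x + r + 28 / 85 - 1 / 2) :=
        mul_nonneg (by linarith) (by linarith)
      linarith
    have h4 : (0.02412 : ℝ) ≤ r := by linarith
    have h6 : (14 / 85 : ℝ) * (1 / 2 - 28 / 85 - r) * (r / 2) ≤ p * (r / 2) := by gcongr
    have h7 : 0 ≤ (r - 0.02412) * (0.0242 - r) := mul_nonneg (by linarith) (by linarith)
    linarith
  · have : 0 ≤ (1 / 2 - x) * (1 / 2 - y) := mul_nonneg (by linarith) (by linarith)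
    linarith

theorem tail_ge {x y z w v : ℝ} (hv : 0 < v) (hwv : v ≤ w) (hzw : w ≤ z) (hyz : z ≤ y)
    (hxy' : y ≤ x) (hsum : x + y + z + (w + v) = 1) (hx2 : x ≤ 1 / 2)
    (hxy : x * y ≤ z + (w + v)) (hxyz : x * y * z ≤ w + v) : 1 / 42 ≤ w + v := by
  have := linear_le_mul_mul (by linarith) (by linarith) hyz hxy' hsum hx2 hxy
  linarith

theorem le_prod_of_last_le {x y z w v t ρ : ℝ} (hv : 0 < v) (hwv : v ≤ w) (hzw : w ≤ z)
    (hyz : z ≤ y) (hxy' : y ≤ x) (hsum : x + y + z + (w + v) = 1) (hx2 : x ≤ 1 / 2)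
    (hxy : x * y ≤ z + (w + v)) (hp : x * y * z * w ≤ 1 / 3486) (hvt : v ≤ t) (ht : t ≤ 1 / 85)
    (hρ1 : 1 / 42 ≤ ρ) (hρ : ρ ≤ w + v) :
    (1 / 36 - ρ / 6) * (ρ - t) ≤ x * y * z * w := by
  have hr := tail_lt hv hwv hzw hyz hxy' hsum hx2 hxy hp
  have hU := linear_le_mul_mul (by linarith) (by linarith) hyz hxy' hsum hx2 hxy
  have h1 : (1 / 36 - (w + v) / 6) * (w + v - t) ≤ x * y * z * w := by
    apply mul_le_mul hU (by linarith) (by linarith)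
    have : 0 < z := by linarith
    have : 0 < y := by linarith
    have : 0 < x := by linarith
    positivity
  have h2 : 0 ≤ (w + v - ρ) * (1 / 36 - (w + v + ρ - t) / 6) := by
    apply mul_nonneg <;> linarith
  nlinarith

/-- Every point of the lattice generated by `ℤ⁵` and `lam / h` that lies in the open simplex
(`h`-scaled here to `y`) is congruent to `lam / h`. -/
def UniqueInterior (lam : Fin 5 → ℕ) (h : ℕ) : Prop :=
  ∀ (k : ℤ) (y : Fin 5 → ℤ), (∀ i, 0 < y i) → ∑ i, y i = h →
    (∀ i, (h : ℤ) ∣ k * lam i - y i) → (h : ℤ) ∣ k - 1 ∧ ∀ i, y i = lam i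

theorem uniqueInterior_of_canonical {lam : Fin 5 → ℕ} (hpos : ∀ i, 0 < lam i) {h : ℕ}
    (hh : h = ∑ i, lam i)
    (hcanon : ∀ κ : ℤ, 2 ≤ κ → κ ≤ (h : ℤ) - 2 →
      ∑ i, Int.fract ((lam i : ℚ) * (κ : ℚ) / (h : ℚ)) ≤ 3) : UniqueInterior lam h := by
  intro k y hy hsum hdvd
  have hhZ : (h : ℤ) = ∑ i, (lam i : ℤ) := by rw [hh]; push_cast; rfl
  simp only [Fin.forall_fin_succ, Fin.sum_univ_five, Fin.succ_zero_eq_one,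
    IsEmpty.forall_iff, and_true] at hpos hy hsum hhZ
  have hlt : ∀ i, y i < h := by
    intro i; fin_cases i <;> simp <;> simp at hy hsum <;> omega
  have hlt' : ∀ i, (lam i : ℤ) < h := by
    intro i; fin_cases i <;> simp <;> simp at hpos hhZ <;> omega
  have hy0 : ∀ i, 0 < y i := by
    intro i; fin_cases i <;> simp <;> simp at hy <;> omega
  have hl0 : ∀ i, 0 < (lam i : ℤ) := by
    intro i; fin_cases i <;> simp <;> simp at hpos <;> omega
  have h0 : (0 : ℤ) < h := (hl0 0).trans (hlt' 0)
  have key : (h : ℤ) ∣ k - 1 := by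
    have hr0 := Int.emod_nonneg k h0.ne'
    have hrh := Int.emod_lt_of_pos k h0
    have hkr : (h : ℤ) ∣ k - k % h := Int.dvd_self_sub_emod
    obtain ⟨r, hr⟩ : ∃ r, r = k % h := ⟨_, rfl⟩
    rw [← hr] at hr0 hrh hkr
    have hd : ∀ i, (h : ℤ) ∣ r * lam i - y i := by
      intro i
      have := dvd_sub (hdvd i) (hkr.mul_right (lam i : ℤ))
      exact this.trans (dvd_of_eq (by ring))
    by_cases hr1 : r = 1
    · rwa [hr1] at hkr
    exfalso
    by_cases hrz : r = 0
    · have := hd 0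
      rw [hrz, zero_mul, zero_sub, dvd_neg] at this
      have := Int.le_of_dvd (hy0 0) this
      linarith [hlt 0]
    by_cases hrm : r = h - 1
    · have e : ∀ i, y i = h - lam i := by
        intro i
        have h1 : (h : ℤ) ∣ y i + lam i := by
          have := dvd_sub (dvd_mul_right (h : ℤ) (lam i)) (hd i)
          rw [hrm] at this
          exact this.trans (dvd_of_eq (by ring))
        obtain ⟨c, hc⟩ := h1
        have := hlt i; have := hlt' i; have := hy0 i; have := hl0 i
        have hc1 : c = 1 := by
          have : 0 < c := by by_contra! hcc; nlinarith
          have : c < 2 := by by_contra! hcc; nlinarith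
          omega
        rw [hc1] at hc; linarith
      have := e 0; have := e 1; have := e 2; have := e 3; have := e 4
      omega
    have hc := hcanon (h - r) (by omega) (by omega)
    have hf : ∀ i, Int.fract ((lam i : ℚ) * ((h - r : ℤ) : ℚ) / (h : ℚ)) = 1 - (y i : ℚ) / h := by
      intro i
      obtain ⟨c, hc⟩ := hd i
      have h0q : (0 : ℚ) < h := by exact_mod_cast h0
      have hyq : (0 : ℚ) < y i := by exact_mod_cast hy0 i
      have hyq' : (y i : ℚ) < h := by exact_mod_cast hlt i
      rw [Int.fract_eq_iff]
      refine ⟨?_, ?_, lam i - c - 1, ?_⟩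
      · rw [sub_nonneg, div_le_one h0q]; exact hyq'.le
      · have : 0 < (y i : ℚ) / h := by positivity
        linarith
      · have hcq : (r : ℚ) * lam i - y i = h * c := by exact_mod_cast hc
        field_simp
        push_cast
        linear_combination -hcq
    simp only [hf] at hc
    simp only [Fin.sum_univ_five] at hc
    have hsq : (y 0 : ℚ) + y 1 + y 2 + y 3 + y 4 = h := by
      have h1 : y 0 + y 1 + y 2 + y 3 + y 4 = h := hsum
      exact_mod_cast h1
    have h0q : (0 : ℚ) < h := by exact_mod_cast h0
    have : (y 0 : ℚ) / h + y 1 / h + y 2 / h + y 3 / h + y 4 / h = 1 := by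
      rw [← add_div, ← add_div, ← add_div, ← add_div, hsq, div_self h0q.ne']
    linarith
  refine ⟨key, fun i => ?_⟩
  have h1 : (h : ℤ) ∣ lam i - y i := by
    have := dvd_sub (hdvd i) (key.mul_right (lam i : ℤ))
    exact this.trans (dvd_of_eq (by ring))
  have := Int.eq_zero_of_abs_lt_dvd h1 (by
    rw [abs_lt]
    constructor <;> linarith [hlt i, hlt' i, hy0 i, hl0 i])
  linarith

section
variable {a b c d e h : ℕ}

theorem UniqueInterior.explicit (H : UniqueInterior ![a, b, c, d, e] h)
    (k y₀ y₁ y₂ y₃ y₄ : ℤ) (h₀ : 0 < y₀) (h₁ : 0 < y₁) (h₂ : 0 < y₂) (h₃ : 0 < y₃) (h₄ : 0 < y₄)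
    (hs : y₀ + y₁ + y₂ + y₃ + y₄ = h) (d₀ : (h : ℤ) ∣ k * a - y₀) (d₁ : (h : ℤ) ∣ k * b - y₁)
    (d₂ : (h : ℤ) ∣ k * c - y₂) (d₃ : (h : ℤ) ∣ k * d - y₃) (d₄ : (h : ℤ) ∣ k * e - y₄) :
    (h : ℤ) ∣ k - 1 ∧ y₀ = a ∧ y₁ = b ∧ y₂ = c ∧ y₃ = d ∧ y₄ = e := by
  have := H k ![y₀, y₁, y₂, y₃, y₄] (by simp [Fin.forall_fin_succ, *])
    (by simp [Fin.sum_univ_five, hs]) (by simp [Fin.forall_fin_succ, *])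
  simpa [Fin.forall_fin_succ] using this

theorem UniqueInterior.two_mul_le (H : UniqueInterior ![a, b, c, d, e] h)
    (hs : a + b + c + d + e = h) (hb : 0 < b) (hc : 0 < c) (hd : 0 < d) (he : 0 < e) :
    2 * a ≤ h := by
  by_contra! hcon
  have := (H.explicit 2 (2 * a - h) (2 * b) (2 * c) (2 * d) (2 * e) (by omega) (by omega)
    (by omega) (by omega) (by omega) (by omega) ⟨1, by ring⟩ ⟨0, by ring⟩ ⟨0, by ring⟩
    ⟨0, by ring⟩ ⟨0, by ring⟩).2.2.1
  omega

theorem UniqueInterior.mul_le (H : UniqueInterior ![a, b, c, d, e] h)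
    (hs : a + b + c + d + e = h) (hc : 0 < c) (hd : 0 < d) (he : 0 < e) :
    a * b ≤ h * (c + d + e) := by
  by_contra! hcon
  have hhs : (a : ℤ) + b + c + d + e = h := by exact_mod_cast hs
  have aux : ∀ m x₀ x₁ : ℤ, m ≤ 0 → |x₀| < a → |x₁| < b → x₀ + x₁ = m * (c + d + e) →
      (h : ℤ) ∣ x₁ + m * b → x₀ = 0 ∧ x₁ = 0 := by
    intro m x₀ x₁ hm h0 h1 hx hd1
    rw [abs_lt] at h0 h1
    have d0 : (h : ℤ) ∣ x₀ + m * a := by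
      have := dvd_sub (dvd_mul_right (h : ℤ) m) hd1
      refine this.trans (dvd_of_eq ?_)
      rw [← hhs]; linear_combination -hx
    obtain ⟨-, e0, e1, -⟩ := H.explicit (1 - m) (a + x₀) (b + x₁) ((1 - m) * c) ((1 - m) * d)
      ((1 - m) * e) (by omega) (by omega) (mul_pos (by omega) (by omega))
      (mul_pos (by omega) (by omega)) (mul_pos (by omega) (by omega))
      (by linear_combination hx + hhs)
      (d0.neg_right.trans (dvd_of_eq (by ring))) (hd1.neg_right.trans (dvd_of_eq (by ring)))
      ⟨0, by ring⟩ ⟨0, by ring⟩ ⟨0, by ring⟩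
    constructor <;> linarith
  have hs0 : 0 < c + d + e := by omega
  have hh0 : 0 < h := by omega
  obtain ⟨p, hp, q, hq, hpq, heq⟩ := Finset.exists_ne_map_eq_of_card_lt_of_maps_to
    (s := Finset.range a ×ˢ Finset.range b) (t := Finset.range h ×ˢ Finset.range (c + d + e))
    (f := fun p => ((p.2 + (p.1 + p.2) / (c + d + e) * b) % h, (p.1 + p.2) % (c + d + e)))
    (by simpa using hcon)
    (by intro p _; simp [Nat.mod_lt _ hs0, Nat.mod_lt _ hh0])
  obtain ⟨p0, p1⟩ := p
  obtain ⟨q0, q1⟩ := q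
  simp only [Finset.mem_product, Finset.mem_range] at hp hq
  simp only [Prod.mk.injEq] at heq
  obtain ⟨heq1, heq2⟩ := heq
  have hP := Nat.mod_add_div (p0 + p1) (c + d + e)
  have hQ := Nat.mod_add_div (q0 + q1) (c + d + e)
  have hD := (Nat.modEq_iff_dvd.1 (show q1 + _ ≡ p1 + _ [MOD h] from heq1.symm))
  rw [heq2] at hP
  generalize (p0 + p1) / (c + d + e) = u at *
  generalize (q0 + q1) / (c + d + e) = v at *
  zify at hP hQ
  push_cast at hD
  apply hpq
  rcases le_total u v with huv | huv
  · obtain ⟨e0, e1⟩ := aux (u - v) (p0 - q0) (p1 - q1) (by omega) (by rw [abs_lt]; omega)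
      (by rw [abs_lt]; omega) (by linear_combination hQ - hP)
      (hD.trans (dvd_of_eq (by ring)))
    ext <;> simp <;> omega
  · obtain ⟨e0, e1⟩ := aux (v - u) (q0 - p0) (q1 - p1) (by omega) (by rw [abs_lt]; omega)
      (by rw [abs_lt]; omega) (by linear_combination hP - hQ)
      (hD.neg_right.trans (dvd_of_eq (by ring)))
    ext <;> simp <;> omega

theorem UniqueInterior.mul_mul_le (H : UniqueInterior ![a, b, c, d, e] h)
    (hs : a + b + c + d + e = h) (hd : 0 < d) (he : 0 < e) :
    a * b * c ≤ h * h * (d + e) := by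
  by_contra! hcon
  have hhs : (a : ℤ) + b + c + d + e = h := by exact_mod_cast hs
  have aux : ∀ m x₀ x₁ x₂ : ℤ, m ≤ 0 → |x₀| < a → |x₁| < b → |x₂| < c →
      x₀ + x₁ + x₂ = m * (d + e) → (h : ℤ) ∣ x₁ + m * b → (h : ℤ) ∣ x₂ + m * c →
      x₀ = 0 ∧ x₁ = 0 ∧ x₂ = 0 := by
    intro m x₀ x₁ x₂ hm h0 h1 h2 hx hd1 hd2
    rw [abs_lt] at h0 h1 h2
    have d0 : (h : ℤ) ∣ x₀ + m * a := by
      have := dvd_sub (dvd_sub (dvd_mul_right (h : ℤ) m) hd1) hd2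
      refine this.trans (dvd_of_eq ?_)
      rw [← hhs]; linear_combination -hx
    obtain ⟨-, e0, e1, e2, -⟩ := H.explicit (1 - m) (a + x₀) (b + x₁) (c + x₂) ((1 - m) * d)
      ((1 - m) * e) (by omega) (by omega) (by omega)
      (mul_pos (by omega) (by omega)) (mul_pos (by omega) (by omega))
      (by linear_combination hx + hhs)
      (d0.neg_right.trans (dvd_of_eq (by ring))) (hd1.neg_right.trans (dvd_of_eq (by ring)))
      (hd2.neg_right.trans (dvd_of_eq (by ring)))
      ⟨0, by ring⟩ ⟨0, by ring⟩
    refine ⟨?_, ?_, ?_⟩ <;> linarith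
  have hs0 : 0 < d + e := by omega
  have hh0 : 0 < h := by omega
  obtain ⟨p, hp, q, hq, hpq, heq⟩ := Finset.exists_ne_map_eq_of_card_lt_of_maps_to
    (s := Finset.range a ×ˢ Finset.range b ×ˢ Finset.range c)
    (t := Finset.range h ×ˢ Finset.range h ×ˢ Finset.range (d + e))
    (f := fun p => ((p.2.1 + (p.1 + p.2.1 + p.2.2) / (d + e) * b) % h,
      (p.2.2 + (p.1 + p.2.1 + p.2.2) / (d + e) * c) % h, (p.1 + p.2.1 + p.2.2) % (d + e)))
    (by simpa [mul_assoc] using hcon)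
    (by intro p _; simp [Nat.mod_lt _ hs0, Nat.mod_lt _ hh0])
  obtain ⟨p0, p1, p2⟩ := p
  obtain ⟨q0, q1, q2⟩ := q
  simp only [Finset.mem_product, Finset.mem_range] at hp hq
  simp only [Prod.mk.injEq] at heq
  obtain ⟨heq1, heq3, heq2⟩ := heq
  have hP := Nat.mod_add_div (p0 + p1 + p2) (d + e)
  have hQ := Nat.mod_add_div (q0 + q1 + q2) (d + e)
  have hD := (Nat.modEq_iff_dvd.1 (show q1 + _ ≡ p1 + _ [MOD h] from heq1.symm))
  have hE := (Nat.modEq_iff_dvd.1 (show q2 + _ ≡ p2 + _ [MOD h] from heq3.symm))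
  rw [heq2] at hP
  generalize (p0 + p1 + p2) / (d + e) = u at *
  generalize (q0 + q1 + q2) / (d + e) = v at *
  zify at hP hQ
  push_cast at hD hE
  apply hpq
  rcases le_total u v with huv | huv
  · obtain ⟨e0, e1, e2⟩ := aux (u - v) (p0 - q0) (p1 - q1) (p2 - q2) (by omega)
      (by rw [abs_lt]; omega) (by rw [abs_lt]; omega) (by rw [abs_lt]; omega)
      (by linear_combination hQ - hP)
      (hD.trans (dvd_of_eq (by ring))) (hE.trans (dvd_of_eq (by ring)))
    ext <;> simp <;> omega
  · obtain ⟨e0, e1, e2⟩ := aux (v - u) (q0 - p0) (q1 - p1) (q2 - p2) (by omega)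
      (by rw [abs_lt]; omega) (by rw [abs_lt]; omega) (by rw [abs_lt]; omega)
      (by linear_combination hP - hQ)
      (hD.neg_right.trans (dvd_of_eq (by ring))) (hE.neg_right.trans (dvd_of_eq (by ring)))
    ext <;> simp <;> omega

theorem UniqueInterior.mul_mul_mul_le (H : UniqueInterior ![a, b, c, d, e] h)
    (hs : a + b + c + d + e = h) (he : 0 < e) :
    a * b * c * d ≤ h ^ 3 := by
  by_contra! hcon
  have hhs : (a : ℤ) + b + c + d + e = h := by exact_mod_cast hs
  have aux : ∀ m x₀ x₁ x₂ x₃ : ℤ, |x₀| < a → |x₁| < b → |x₂| < c → |x₃| < d →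
      x₀ + x₁ + x₂ + x₃ ≤ 0 → (h : ℤ) ∣ x₀ + m * a → (h : ℤ) ∣ x₁ + m * b →
      (h : ℤ) ∣ x₂ + m * c → (h : ℤ) ∣ x₃ + m * d →
      (h : ℤ) ∣ m ∧ x₀ = 0 ∧ x₁ = 0 ∧ x₂ = 0 ∧ x₃ = 0 := by
    intro m x₀ x₁ x₂ x₃ h0 h1 h2 h3 hx d0 d1 d2 d3
    rw [abs_lt] at h0 h1 h2 h3
    have d4 : (h : ℤ) ∣ -(x₀ + x₁ + x₂ + x₃) + m * e := by
      have := dvd_sub (dvd_sub (dvd_sub (dvd_sub (dvd_mul_right (h : ℤ) m) d0) d1) d2) d3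
      refine this.trans (dvd_of_eq ?_)
      rw [← hhs]; ring
    obtain ⟨hm, e0, e1, e2, e3, -⟩ := H.explicit (1 - m) (a + x₀) (b + x₁) (c + x₂) (d + x₃)
      (e - (x₀ + x₁ + x₂ + x₃)) (by omega) (by omega) (by omega) (by omega) (by omega)
      (by linear_combination hhs)
      (d0.neg_right.trans (dvd_of_eq (by ring))) (d1.neg_right.trans (dvd_of_eq (by ring)))
      (d2.neg_right.trans (dvd_of_eq (by ring))) (d3.neg_right.trans (dvd_of_eq (by ring)))
      (d4.neg_right.trans (dvd_of_eq (by ring)))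
    refine ⟨by simpa using hm, ?_, ?_, ?_, ?_⟩ <;> linarith
  have hh0 : 0 < h := by omega
  obtain ⟨p, hp, q, hq, hpq, heq⟩ := Finset.exists_ne_map_eq_of_card_lt_of_maps_to
    (s := Finset.range h ×ˢ Finset.range a ×ˢ Finset.range b ×ˢ Finset.range c ×ˢ Finset.range d)
    (t := Finset.range h ×ˢ Finset.range h ×ˢ Finset.range h ×ˢ Finset.range h)
    (f := fun p => ((p.2.1 + p.1 * a) % h, (p.2.2.1 + p.1 * b) % h, (p.2.2.2.1 + p.1 * c) % h,
      (p.2.2.2.2 + p.1 * d) % h))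
    (by
      simp only [Finset.card_product, Finset.card_range]
      calc h * (h * (h * h)) = h * h ^ 3 := by ring
        _ < h * (a * b * c * d) := by gcongr
        _ = _ := by ring)
    (by intro p _; simp [Nat.mod_lt _ hh0])
  obtain ⟨u, p0, p1, p2, p3⟩ := p
  obtain ⟨v, q0, q1, q2, q3⟩ := q
  simp only [Finset.mem_product, Finset.mem_range] at hp hq
  simp only [Prod.mk.injEq] at heq
  obtain ⟨heq0, heq1, heq2, heq3⟩ := heq
  have d0 := (Nat.modEq_iff_dvd.1 (show q0 + _ ≡ p0 + _ [MOD h] from heq0.symm))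
  have d1 := (Nat.modEq_iff_dvd.1 (show q1 + _ ≡ p1 + _ [MOD h] from heq1.symm))
  have d2 := (Nat.modEq_iff_dvd.1 (show q2 + _ ≡ p2 + _ [MOD h] from heq2.symm))
  have d3 := (Nat.modEq_iff_dvd.1 (show q3 + _ ≡ p3 + _ [MOD h] from heq3.symm))
  push_cast at d0 d1 d2 d3
  apply hpq
  have huv : (h : ℤ) ∣ u - v → u = v := by
    intro hd
    have := Int.eq_zero_of_abs_lt_dvd hd (by rw [abs_lt]; omega)
    omega
  rcases le_total ((p0 : ℤ) + p1 + p2 + p3) (q0 + q1 + q2 + q3) with hle | hle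
  · obtain ⟨hm, e0, e1, e2, e3⟩ := aux (u - v) (p0 - q0) (p1 - q1) (p2 - q2) (p3 - q3)
      (by rw [abs_lt]; omega) (by rw [abs_lt]; omega) (by rw [abs_lt]; omega)
      (by rw [abs_lt]; omega) (by omega)
      (d0.trans (dvd_of_eq (by ring))) (d1.trans (dvd_of_eq (by ring)))
      (d2.trans (dvd_of_eq (by ring))) (d3.trans (dvd_of_eq (by ring)))
    have := huv hm
    ext <;> simp <;> omega
  · obtain ⟨hm, e0, e1, e2, e3⟩ := aux (v - u) (q0 - p0) (q1 - p1) (q2 - p2) (q3 - p3)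
      (by rw [abs_lt]; omega) (by rw [abs_lt]; omega) (by rw [abs_lt]; omega)
      (by rw [abs_lt]; omega) (by omega)
      (d0.neg_right.trans (dvd_of_eq (by ring))) (d1.neg_right.trans (dvd_of_eq (by ring)))
      (d2.neg_right.trans (dvd_of_eq (by ring))) (d3.neg_right.trans (dvd_of_eq (by ring)))
    have := huv (hm.neg_right.trans (dvd_of_eq (by ring)))
    ext <;> simp <;> omega

end

theorem UniqueInterior.le_and_eq {a b c d e h : ℕ} (H : UniqueInterior ![a, b, c, d, e] h)
    (hs : a + b + c + d + e = h) (he : 0 < e) (hed : e ≤ d) (hdc : d ≤ c) (hcb : c ≤ b)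
    (hba : b ≤ a) :
    h ≤ 3486 ∧ (h = 3486 → a = 1743 ∧ b = 1162 ∧ c = 498 ∧ d = 42 ∧ e = 41) := by
  suffices main : 3486 ≤ h →
      h = 3486 ∧ a = 1743 ∧ b = 1162 ∧ c = 498 ∧ d = 42 ∧ e = 41 from
    ⟨by by_contra! hc; have := (main hc.le).1; omega, fun hh => (main hh.ge).2⟩
  intro hh
  have hd0 : 0 < d := by omega
  have hc0 : 0 < c := by omega
  have hb0 : 0 < b := by omega
  have ha0 : 0 < a := by omega
  have T1 : (2 : ℝ) * a ≤ h := by exact_mod_cast H.two_mul_le hs hb0 hc0 hd0 he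
  have T2 : (a : ℝ) * b ≤ h * (c + d + e) := by exact_mod_cast H.mul_le hs hc0 hd0 he
  have T3 : (a : ℝ) * b * c ≤ h * h * (d + e) := by exact_mod_cast H.mul_mul_le hs hd0 he
  have T4 : (a : ℝ) * b * c * d ≤ h ^ 3 := by exact_mod_cast H.mul_mul_mul_le hs he
  have hhR : (3486 : ℝ) ≤ h := by exact_mod_cast hh
  have hR : (0 : ℝ) < h := by linarith
  have hsum : (a / h : ℝ) + b / h + c / h + (d / h + e / h) = 1 := by
    rw [← add_div, ← add_div, ← add_div, ← add_div, div_eq_one_iff_eq hR.ne']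
    exact_mod_cast (by omega : a + b + c + (d + e) = h)
  have ea : (a : ℝ) = a / h * h := by field_simp
  have eb : (b : ℝ) = b / h * h := by field_simp
  have ec : (c : ℝ) = c / h * h := by field_simp
  have ed : (d : ℝ) = d / h * h := by field_simp
  have ee : (e : ℝ) = e / h * h := by field_simp
  have hv : (0 : ℝ) < e / h := by positivity
  have hwv : (e / h : ℝ) ≤ d / h := by gcongr
  have hzw : (d / h : ℝ) ≤ c / h := by gcongr
  have hyz : (c / h : ℝ) ≤ b / h := by gcongr
  have hxy' : (b / h : ℝ) ≤ a / h := by gcongr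
  have hx2 : (a / h : ℝ) ≤ 1 / 2 := by rw [div_le_iff₀ hR]; linarith
  have hxy : (a / h * (b / h) : ℝ) ≤ c / h + (d / h + e / h) := by
    field_simp; linarith
  have hxyz : (a / h * (b / h) * (c / h) : ℝ) ≤ d / h + e / h := by
    field_simp; linarith
  have hph : (a / h * (b / h) * (c / h) * (d / h) : ℝ) ≤ 1 / h := by
    field_simp; linarith
  have hp : (a / h * (b / h) * (c / h) * (d / h) : ℝ) ≤ 1 / 3486 :=
    hph.trans (by gcongr)
  have hr42 := tail_ge hv hwv hzw hyz hxy' hsum hx2 hxy hxyz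
  obtain ⟨hx, hy, hz⟩ := lt_of_prod_le hv hwv hzw hyz hxy' hsum hx2 hxy hxyz hp
  rw [div_lt_div_iff₀ (by norm_num) hR] at hx hy hz
  have h85 : 85 * e ≤ h := by
    by_contra! hcon
    have hx' : 42 * h < a * 85 := by exact_mod_cast hx
    have hy' : 28 * h < b * 85 := by exact_mod_cast hy
    have hz' : 12 * h < c * 85 := by exact_mod_cast hz
    have := (H.explicit 85 (85 * a - 42 * h) (85 * b - 28 * h) (85 * c - 12 * h) (85 * d - h)
      (85 * e - h) (by omega) (by omega) (by omega) (by omega) (by omega) (by omega)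
      ⟨42, by ring⟩ ⟨28, by ring⟩ ⟨12, by ring⟩ ⟨1, by ring⟩ ⟨1, by ring⟩).1
    have := Int.le_of_dvd (by norm_num) this
    omega
  have hvt : (e / h : ℝ) ≤ 1 / 85 := by
    rw [div_le_div_iff₀ hR (by norm_num)]
    exact_mod_cast (by omega : e * 85 ≤ 1 * h)
  have hb1 := (le_prod_of_last_le hv hwv hzw hyz hxy' hsum hx2 hxy hp hvt le_rfl le_rfl hr42).trans
    hph
  have hh' : h = 3486 := by
    have : h < 3487 := by
      by_contra! hcon
      have hconR : (3487 : ℝ) ≤ h := by exact_mod_cast hcon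
      have := one_div_le_one_div_of_le (by norm_num) hconR
      norm_num at hb1 this
      linarith
    omega
  subst hh'
  have he41 : e ≤ 41 := by omega
  have hde : d + e = 83 := by
    have h1 : 83 ≤ d + e := by
      have : (83 : ℝ) ≤ d + e := by push_cast at hr42; linarith
      exact_mod_cast this
    by_contra hne
    have h2 : (84 : ℝ) ≤ d + e := by exact_mod_cast (by omega : 84 ≤ d + e)
    have h3 : (e : ℝ) ≤ 41 := by exact_mod_cast he41
    have := (le_prod_of_last_le (t := 41 / 3486) (ρ := 84 / 3486) hv hwv hzw hyz hxy' hsum hx2 hxy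
      hp (by push_cast; linarith) (by norm_num) (by norm_num) (by push_cast; linarith)).trans hph
    norm_num at this
  have hU := linear_le_mul_mul (by linarith) (add_pos (hv.trans_le hwv) hv) hyz hxy' hsum hx2 hxy
  have hdeR : (d : ℝ) + e = 83 := by exact_mod_cast hde
  have hp1 : 1743 * 1162 * 498 ≤ a * b * c := by
    have : (1743 * 1162 * 498 : ℝ) ≤ a * b * c := by push_cast at hU; linarith
    exact_mod_cast this
  have hp2 : a * b * c * d ≤ 3486 ^ 3 := by exact_mod_cast T4
  have hd42 : 42 ≤ d := by omega
  have hp3 : a * b * c * 42 ≤ 3486 ^ 3 := (Nat.mul_le_mul_left _ hd42).trans hp2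
  have hd : d = 42 := by
    by_contra hne
    have : a * b * c * 43 ≤ 3486 ^ 3 :=
      (Nat.mul_le_mul_left _ (by omega : 43 ≤ d)).trans hp2
    omega
  have hprod : a * (b * c) = 1743 * 1162 * 498 := by rw [← mul_assoc]; omega
  have ha : a = 1743 := by
    have h1 : 42 * 3486 < a * 85 := by exact_mod_cast hx
    have h2 : 2 * a ≤ 3486 := by exact_mod_cast T1
    have h3 : a ∣ 1743 * 1162 * 498 := ⟨_, hprod.symm⟩
    have h4 : 1722 < a := by omega
    have h5 : a ≤ 1743 := by omega
    clear * - h3 h4 h5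
    interval_cases a <;> revert h3 <;> decide
  subst ha
  have hbc : b = 1660 - c := by omega
  have h12 : 28 * 3486 < b * 85 := by exact_mod_cast hy
  have h13 : 12 * 3486 < c * 85 := by exact_mod_cast hz
  have hc : c = 498 := by
    have h4 : 492 < c := by omega
    have h5 : c ≤ 511 := by omega
    subst hbc
    clear * - hprod h4 h5
    interval_cases c <;> omega
  omega

/-- **Theorem 3.5(2).** For well-formed weights `(λ₀,…,λ₄)` with `gcd = 1` such that
`ℙ(λ₀,…,λ₄)` has at worst canonical singularities, the sum `h = λ₀ + ⋯ + λ₄` satisfies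
`h ≤ 3486`, with `h = 3486` only for the weights `(41, 42, 498, 1162, 1743)` up to
permutation. -/
theorem stmt_17 (lam : Fin 5 → ℕ)
    (hpos : ∀ i, 0 < lam i)
    (hgcd : Finset.univ.gcd lam = 1)
    (hwf : ∀ i : Fin 5, (Finset.univ.erase i).gcd lam = 1)
    (h : ℕ) (hh : h = ∑ i, lam i)
    (hcanon : ∀ κ : ℤ, 2 ≤ κ → κ ≤ (h : ℤ) - 2 →
      1 ≤ ∑ i, Int.fract ((lam i : ℚ) * (κ : ℚ) / (h : ℚ)) ∧
        ∑ i, Int.fract ((lam i : ℚ) * (κ : ℚ) / (h : ℚ)) ≤ 3) :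
    h ≤ 3486 ∧
      (h = 3486 → ∃ σ : Equiv.Perm (Fin 5),
        (fun i => lam (σ i)) = ![41, 42, 498, 1162, 1743]) := by
  have hex : ∃ τ : Equiv.Perm (Fin 5), Antitone (lam ∘ τ) :=
    ⟨Tuple.sort (OrderDual.toDual ∘ lam), Tuple.monotone_sort (OrderDual.toDual ∘ lam)⟩
  obtain ⟨τ, hτ⟩ := hex
  have hsum : h = ∑ i, lam (τ i) := by rw [hh, Equiv.sum_comp τ lam]
  have H : UniqueInterior (lam ∘ τ) h := by
    refine uniqueInterior_of_canonical (fun i => hpos _) hsum fun κ h1 h2 => ?_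
    refine le_of_eq_of_le ?_ (hcanon κ h1 h2).2
    exact Equiv.sum_comp τ fun i => Int.fract ((lam i : ℚ) * (κ : ℚ) / (h : ℚ))
  have hvec : lam ∘ τ = ![lam (τ 0), lam (τ 1), lam (τ 2), lam (τ 3), lam (τ 4)] := by
    ext i; fin_cases i <;> rfl
  rw [hvec] at H
  obtain ⟨hle, heq⟩ := H.le_and_eq (by rw [hsum, Fin.sum_univ_five]) (hpos _)
    (hτ (by decide : (3 : Fin 5) ≤ 4)) (hτ (by decide : (2 : Fin 5) ≤ 3))
    (hτ (by decide : (1 : Fin 5) ≤ 2)) (hτ (by decide : (0 : Fin 5) ≤ 1))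
  refine ⟨hle, fun hh' => ⟨Fin.revPerm.trans τ, ?_⟩⟩
  obtain ⟨h0, h1, h2, h3, h4⟩ := heq hh'
  ext i
  fin_cases i
  exacts [h4, h3, h2, h1, h0]
end

section
/- Let (λ_0,λ_1,λ_2,λ_3,λ_4) be a well-formed tuple of positive integers with gcd equal to 1 and h = λ_0 + ⋯ + λ_4, such that for every integer κ with 2 ≤ κ ≤ h − 2 one has 1 ≤ Σ_{i=0}^4 {λ_i κ / h} ≤ 3 (i.e. ℙ(λ_0,…,λ_4) has at worst canonical singularities). Then the degree satisfies h^4/(λ_0λ_1λ_2λ_3λ_4) ≤ 3528, with equality if and only if, up to permutation, (λ_0,…,λ_4) = (1, 1, 12, 28, 42). -/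
/-- **Minkowski's theorem on linear forms**. -/
theorem exists_int_abs_mulVec_lt {ι : Type*} [Fintype ι] [DecidableEq ι] (A : Matrix ι ι ℝ)
    (c : ι → ℝ) (hc : ∀ i, 0 < c i) (hA : A.det ≠ 0) (hlt : |A.det| < ∏ i, c i) :
    ∃ n : ι → ℤ, n ≠ 0 ∧ ∀ i, |A.mulVec (fun j => (n j : ℝ)) i| < c i := by
  let box : Set (ι → ℝ) := Set.univ.pi fun i => Set.Ioo (-c i) (c i)
  have hbox : ∀ v, v ∈ box ↔ ∀ i, |v i| < c i := by simp [box, abs_lt]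
  let f : (ι → ℝ) →ₗ[ℝ] ι → ℝ := Matrix.toLin' A
  have hdet : LinearMap.det f = A.det := LinearMap.det_toLin' A
  have hvol : MeasureTheory.volume (f ⁻¹' box) =
      ENNReal.ofReal (|A.det|⁻¹ * (2 ^ Fintype.card ι * ∏ i, c i)) := by
    rw [MeasureTheory.Measure.addHaar_preimage_linearMap _ (by rwa [hdet]), hdet,
      Real.volume_pi_Ioo, ← ENNReal.ofReal_prod_of_nonneg
        (fun i _ => by linarith [hc i]), ← ENNReal.ofReal_mul (abs_nonneg _), abs_inv]
    congr 2
    rw [Fintype.card, ← Finset.prod_const, ← Finset.prod_mul_distrib]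
    exact Finset.prod_congr rfl fun i _ => by ring
  have hfund : MeasureTheory.volume (ZSpan.fundamentalDomain (Pi.basisFun ℝ ι)) = 1 := by
    simp [ZSpan.fundamentalDomain_pi_basisFun, MeasureTheory.volume_pi_pi]
  have : Countable (Submodule.span ℤ (Set.range (Pi.basisFun ℝ ι))).toAddSubgroup :=
    inferInstanceAs (Countable (Submodule.span ℤ (Set.range (Pi.basisFun ℝ ι))))
  obtain ⟨⟨v, hvL⟩, hv0, hv⟩ :=
    MeasureTheory.exists_ne_zero_mem_lattice_of_measure_mul_two_pow_lt_measure
      (μ := MeasureTheory.volume) (s := f ⁻¹' box)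
      (ZSpan.isAddFundamentalDomain' (Pi.basisFun ℝ ι) MeasureTheory.volume)
      (fun v hv => by
        rw [Set.mem_preimage, hbox] at hv ⊢
        simpa using hv)
      ((convex_pi fun i _ => convex_Ioo _ _).linear_preimage f)
      (by
        rw [hfund, hvol, one_mul, Module.finrank_fintype_fun_eq_card,
          show (2 : ENNReal) ^ Fintype.card ι = ENNReal.ofReal (2 ^ Fintype.card ι) by
            rw [ENNReal.ofReal_pow (by norm_num)]; norm_num,
          ENNReal.ofReal_lt_ofReal_iff_of_nonneg (by positivity)]
        have hpos : 0 < |A.det| := abs_pos.2 hA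
        rw [inv_mul_eq_div, lt_div_iff₀ hpos]
        gcongr)
  have hint := ((Pi.basisFun ℝ ι).mem_span_iff_repr_mem ℤ v).1 hvL
  simp only [Pi.basisFun_repr, Set.mem_range, algebraMap_int_eq, eq_intCast] at hint
  choose n hn using hint
  obtain rfl : (fun j => (n j : ℝ)) = v := funext hn
  refine ⟨n, ?_, ?_⟩
  · rintro rfl
    exact hv0 (Subtype.ext (by ext; simp))
  · simpa [f, hbox] using hv

/-- The arithmetic form of the statement that a simplex with canonical singularities has a unique
interior lattice point: the only positive representative of a multiple of the weights whose
entries add up to the sum of the weights is the tuple of weights itself. -/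
theorem eq_weights_of_modEq {ι : Type*} [Fintype ι] (hcard : 3 ≤ Fintype.card ι) {w : ι → ℤ}
    (hw : ∀ i, 0 < w i) {h : ℤ} (hh : ∑ i, w i = h)
    (hcan : ∀ κ : ℤ, 2 ≤ κ → κ ≤ h - 2 →
      ∑ i, w i * κ % h ≤ ((Fintype.card ι : ℤ) - 2) * h)
    {b : ι → ℤ} (hb : ∀ i, 0 < b i) (hbh : ∑ i, b i = h) {k : ℤ}
    (hk : ∀ i, b i ≡ w i * k [ZMOD h]) : b = w := by
  classical
  have lt_of_sum : ∀ {c : ι → ℤ}, (∀ i, 0 < c i) → ∑ i, c i = h → ∀ i, c i < h := by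
    intro c hc hs i
    obtain ⟨j, hj⟩ := Fintype.exists_ne_of_one_lt_card (by omega) i
    rw [← hs]
    exact Finset.single_lt_sum hj (Finset.mem_univ _) (Finset.mem_univ _) (hc j)
      fun k _ _ => (hc k).le
  have hne : Nonempty ι := Fintype.card_pos_iff.1 (by omega)
  obtain ⟨i₀⟩ := hne
  have hpos : 0 < h := (hb i₀).trans (lt_of_sum hb hbh i₀)
  have mod_eq : ∀ {x y : ℤ}, 0 ≤ x → x < h → x ≡ y [ZMOD h] → y % h = x := by
    intro x y h0 h1 hxy
    rw [← hxy, Int.emod_eq_of_lt h0 h1]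
  obtain ⟨r, hr0, hrh, hrk⟩ : ∃ r, 0 ≤ r ∧ r < h ∧ k ≡ r [ZMOD h] :=
    ⟨k % h, Int.emod_nonneg _ hpos.ne', Int.emod_lt_of_pos _ hpos, (Int.mod_modEq _ _).symm⟩
  have hr : ∀ i, b i ≡ w i * r [ZMOD h] := fun i => (hk i).trans (hrk.mul_left _)
  have hneg : ∀ i, w i * (h - r) % h = h - b i := by
    intro i
    refine mod_eq (by linarith [lt_of_sum hb hbh i]) (by linarith [hb i]) ?_
    have : h - b i ≡ w i * h - w i * r [ZMOD h] :=
      Int.ModEq.sub (by simp [Int.ModEq]) (hr i)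
    rwa [← mul_sub] at this
  have hsum : ∑ i, (h - b i) = ((Fintype.card ι : ℤ) - 1) * h := by
    rw [Finset.sum_sub_distrib, hbh]
    simp
    ring
  rcases lt_or_ge r 2 with h2 | h2
  · interval_cases r
    · have := mod_eq (hb i₀).le (lt_of_sum hb hbh i₀) (hr i₀)
      simp at this
      linarith [hb i₀]
    · funext i
      have := mod_eq (hb i).le (lt_of_sum hb hbh i) (hr i)
      rw [mul_one, Int.emod_eq_of_lt (hw i).le (lt_of_sum hw hh i)] at this
      exact this.symm
  rcases eq_or_lt_of_le (show r ≤ h - 1 by omega) with rfl | h1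
  · have : ∑ i, w i = ∑ i, (h - b i) := Finset.sum_congr rfl fun i _ => by
      rw [← hneg i, sub_sub_cancel, mul_one, Int.emod_eq_of_lt (hw i).le (lt_of_sum hw hh i)]
    rw [hsum, hh] at this
    have h3 : (3 : ℤ) ≤ Fintype.card ι := by exact_mod_cast hcard
    nlinarith
  · have := hcan (h - r) (by omega) (by omega)
    rw [Finset.sum_congr rfl fun i _ => hneg i, hsum] at this
    linarith

/-- Averkov's product inequality for the barycentric coordinates `w i / h` of the unique interior
lattice point of a simplex. -/
theorem prod_div_le_sum_compl_div {ι : Type*} [Fintype ι] [DecidableEq ι]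
    (hcard : 3 ≤ Fintype.card ι) {w : ι → ℤ}
    (hw : ∀ i, 0 < w i) {h : ℤ} (hh : ∑ i, w i = h)
    (hcan : ∀ κ : ℤ, 2 ≤ κ → κ ≤ h - 2 →
      ∑ i, w i * κ % h ≤ ((Fintype.card ι : ℤ) - 2) * h)
    {s : Finset ι} (hs : s ≠ Finset.univ) :
    ∏ i ∈ s, (w i / h : ℝ) ≤ ∑ i ∈ sᶜ, (w i / h : ℝ) := by
  obtain ⟨i₁, hi₁⟩ : ∃ i, i ∉ s := by
    by_contra! hall
    exact hs (Finset.eq_univ_iff_forall.2 hall)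
  have hpos : 0 < h := by
    rw [← hh]
    exact Finset.sum_pos (fun i _ => hw i) ⟨i₁, Finset.mem_univ _⟩
  have hposR : (0 : ℝ) < h := by exact_mod_cast hpos
  let x : ι → ℝ := fun i => w i / h
  have hx : ∀ i, 0 < x i := fun i => div_pos (by exact_mod_cast hw i) hposR
  have hx1 : ∑ i ∈ s, x i + ∑ i ∈ sᶜ, x i = 1 := by
    rw [Finset.sum_add_sum_compl, ← Finset.sum_div, div_eq_one_iff_eq hposR.ne']
    exact_mod_cast hh
  have hcompl : 0 < ∑ i ∈ sᶜ, x i :=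
    Finset.sum_pos (fun i _ => hx i) ⟨i₁, by simpa using hi₁⟩
  by_contra! hlt
  let A : Matrix s s ℝ := 1 + Matrix.replicateCol Unit (fun i : s => x i) *
    Matrix.replicateRow Unit (fun _ : s => (-1 : ℝ))
  have hA : A.det = ∑ i ∈ sᶜ, x i := by
    rw [Matrix.det_one_add_replicateCol_mul_replicateRow]
    simp only [dotProduct, neg_mul, one_mul, Finset.sum_neg_distrib]
    rw [Finset.sum_coe_sort s x]
    linarith
  obtain ⟨n, hn0, hn, hsum⟩ : ∃ n : s → ℤ, n ≠ 0 ∧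
      (∀ i, |(n i : ℝ) - (∑ j, n j : ℤ) * x i| < x i) ∧ 0 ≤ ∑ j, n j := by
    obtain ⟨n, hn0, hn⟩ := exists_int_abs_mulVec_lt A (fun i => x i) (fun i => hx i)
      (by rw [hA]; exact hcompl.ne')
      (by rw [hA, abs_of_pos hcompl, Finset.prod_coe_sort s x]; exact hlt)
    have hn' : ∀ i, |(n i : ℝ) - (∑ j, n j : ℤ) * x i| < x i := by
      intro i
      convert hn i using 2
      simp only [A, Matrix.add_mulVec, Matrix.one_mulVec, ← Matrix.mulVec_mulVec]
      simp only [Pi.add_apply, Matrix.mulVec, dotProduct, Matrix.replicateCol_apply,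
        Matrix.replicateRow_apply, Finset.univ_unique, Finset.sum_singleton]
      simp [sub_eq_add_neg, mul_comm]
    rcases le_total 0 (∑ j, n j) with h0 | h0
    · exact ⟨n, hn0, hn', h0⟩
    · refine ⟨-n, by simpa using hn0, fun i => ?_, by simpa using h0⟩
      rw [← abs_neg]
      convert hn' i using 2
      simp
      ring
  let m : ι → ℤ := fun i => if hi : i ∈ s then n ⟨i, hi⟩ else 0
  have hm : ∑ i, m i = ∑ j, n j := by
    rw [← Finset.sum_subset s.subset_univ (fun i _ hi => by simp [m, hi]),
      ← Finset.sum_coe_sort s m]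
    exact Finset.sum_congr rfl fun i _ => by simp [m]
  have key := eq_weights_of_modEq hcard hw hh hcan
    (b := fun i => w i * (∑ j, n j + 1) - h * m i) (k := ∑ j, n j + 1)
    (fun i => by
      by_cases hi : i ∈ s
      · have h1 := (abs_lt.1 (hn ⟨i, hi⟩)).2
        have h2 : (w i : ℝ) = h * x i := by simp only [x]; field_simp
        have h3 : (0 : ℝ) < w i * ((∑ j, n j : ℤ) + 1) - h * n ⟨i, hi⟩ := by
          rw [h2]
          nlinarith
        simp only [m, hi, dif_pos]
        exact_mod_cast h3
      · simp only [m, hi, dif_neg, not_false_eq_true, mul_zero, sub_zero]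
        exact mul_pos (hw i) (by omega))
    (by rw [Finset.sum_sub_distrib, ← Finset.sum_mul, ← Finset.mul_sum, hm, hh]; ring)
    (fun i => by simp [Int.ModEq])
  have hzero : ∑ j, n j = 0 := by
    have := congrFun key i₁
    simp only [m, hi₁, dif_neg, not_false_eq_true] at this
    nlinarith [hw i₁]
  refine hn0 (funext fun i => ?_)
  have := congrFun key i
  simp only [m, i.2, dif_pos, hzero] at this
  simp at this
  simpa [hpos.ne'] using this

theorem one_add_mul_le_of_ordered {a b : ℝ} (hab : b ≤ a) (h0 : 0 < b) (ha : a ≤ 1 / 2)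
    (hq : a * b ≤ 1 - a - b) (hc : 1 - a - b ≤ b * (1 + a * b)) :
    1 + a * b ≤ 42 * (a * b) * (1 - a - b) ∧
      (1 + a * b = 42 * (a * b) * (1 - a - b) → a = 1 / 2 ∧ b = 1 / 3) := by
  have hb : 11 / 50 ≤ b := by nlinarith [mul_nonneg (sub_nonneg.2 ha) (sq_nonneg b)]
  have hs : 1 / 2 ≤ a + b := by nlinarith
  rcases le_or_gt b (1 / 3) with hb3 | hb3
  · have key : 42 * (a * b) * (1 - a - b) - (1 + a * b) =
        (7 * b - 1) * (1 - 3 * b) + (1 / 2 - a) * (b * (42 * (a + b - 1 / 2) + 1)) := by ring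
    have h1 : 0 ≤ (7 * b - 1) * (1 - 3 * b) := mul_nonneg (by linarith) (by linarith)
    have hp : 0 < b * (42 * (a + b - 1 / 2) + 1) := mul_pos h0 (by linarith)
    have h2 := mul_nonneg (sub_nonneg.2 ha) hp.le
    refine ⟨by linarith, fun he => ?_⟩
    have e1 : (7 * b - 1) * (1 - 3 * b) = 0 := by linarith
    have e2 : (1 / 2 - a) * (b * (42 * (a + b - 1 / 2) + 1)) = 0 := by linarith
    constructor
    · rcases mul_eq_zero.1 e2 with h | h <;> linarith
    · rcases mul_eq_zero.1 e1 with h | h <;> linarith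
  · have hq9 : 1 / 9 < a * b := by nlinarith
    rcases lt_or_ge (a * b) (1 / 6) with h6 | h6
    · have h1 : 0 < (1 - 6 * (a * b)) * (21 * (a * b) - 1) :=
        mul_pos (by linarith) (by linarith)
      have h2 : 0 ≤ (a - 1 / 3) * (b - 1 / 3) := mul_nonneg (by linarith) (by linarith)
      have h3 : 0 ≤ a * b * ((1 - a - b) - (2 / 3 - 3 * (a * b))) :=
        mul_nonneg (by linarith) (by linarith)
      have h4 : 1 + a * b < 42 * (a * b) * (1 - a - b) := by nlinarith
      exact ⟨h4.le, fun he => absurd he h4.ne⟩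
    · have h1 : 0 ≤ a * b * ((1 - a - b) - a * b) := mul_nonneg (by linarith) (by linarith)
      have h2 : 0 ≤ (6 * (a * b) - 1) * (7 * (a * b) + 1) := mul_nonneg (by linarith) (by linarith)
      refine ⟨by linarith, fun he => ?_⟩
      have e1 : a * b = 1 / 6 := by nlinarith
      have e2 : 1 - a - b = 1 / 6 := by rw [e1] at he; linarith
      have e3 : (a - 1 / 2) * (a - 1 / 3) = 0 := by
        rw [show b = 5 / 6 - a by linarith] at e1
        linarith
      rcases mul_eq_zero.1 e3 with h | h
      · exact ⟨by linarith, by linarith⟩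
      · linarith

theorem lt_mul_of_third_eq_second {a b : ℝ} (hab : b ≤ a) (ha : a ≤ 1 / 2)
    (hb : 1 ≤ a + 4 * b) (hc : a * b * b ≤ 1 - a - b - b) :
    1 / 1764 < a * b * (b * (1 - a - b - b)) := by
  have h5 : 1 / 5 ≤ a := by linarith
  have h8 : 1 / 8 ≤ b := by linarith
  obtain ⟨v, hv⟩ : ∃ v, v = 1 - a - b - b := ⟨_, rfl⟩
  rw [← hv] at hc ⊢
  have bound : ∀ A B V : ℝ, 0 ≤ A → 0 ≤ B → 0 ≤ V → 1 / 1764 < A * B * (B * V) →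
      A ≤ a → B ≤ b → V ≤ v → 1 / 1764 < a * b * (b * v) := by
    intro A B V hA hB hV hlt h1 h2 h3
    exact hlt.trans_le (by gcongr)
  have bound_sq : ∀ A B : ℝ, 0 ≤ A → 0 ≤ B → 1 / 1764 < A * B * (B * (A * B * B)) →
      A ≤ a → B ≤ b → 1 / 1764 < a * b * (b * v) := by
    intro A B hA hB hlt h1 h2
    exact bound A B (A * B * B) hA hB (by positivity) hlt h1 h2
      (hc.trans' (by gcongr))
  rcases le_or_gt b (3 / 20) with h1 | h1
  · exact bound (1 / 5) (1 / 8) (1 / 5) (by norm_num) (by norm_num) (by norm_num) (by norm_num)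
      h5 h8 (by linarith)
  rcases le_or_gt b (187 / 1000) with h2 | h2
  · exact bound (1 / 5) (3 / 20) (63 / 500) (by norm_num) (by norm_num) (by norm_num)
      (by norm_num) h5 h1.le (by linarith)
  rcases le_or_gt b (209 / 1000) with h3 | h3
  · exact bound (1 / 5) (187 / 1000) (41 / 500) (by norm_num) (by norm_num) (by norm_num)
      (by norm_num) h5 h2.le (by linarith)
  rcases le_or_gt b (109 / 500) with h4 | h4
  · exact bound (209 / 1000) (209 / 1000) (8 / 125) (by norm_num) (by norm_num) (by norm_num)
      (by norm_num) (by linarith) h3.le (by linarith)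
  rcases le_or_gt b (111 / 500) with h6 | h6
  · exact bound (109 / 500) (109 / 500) (7 / 125) (by norm_num) (by norm_num) (by norm_num)
      (by norm_num) (by linarith) h4.le (by linarith)
  rcases le_or_gt (13 / 250) v with h7 | h7
  · exact bound (111 / 500) (111 / 500) (13 / 250) (by norm_num) (by norm_num) (by norm_num)
      (by norm_num) (by linarith) h6.le h7
  rcases le_or_gt a (39 / 100) with h8 | h8
  · exact bound_sq (79 / 250) (279 / 1000) (by norm_num) (by norm_num) (by norm_num)
      (by linarith) (by linarith)
  rcases le_or_gt a (9 / 20) with h9 | h9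
  · exact bound_sq (39 / 100) (249 / 1000) (by norm_num) (by norm_num) (by norm_num)
      (by linarith) (by linarith)
  rcases le_or_gt a (12 / 25) with h10 | h10
  · exact bound_sq (9 / 20) (117 / 500) (by norm_num) (by norm_num) (by norm_num)
      (by linarith) (by linarith)
  · exact bound_sq (12 / 25) (28 / 125) (by norm_num) (by norm_num) (by norm_num)
      (by linarith) (by linarith)

theorem lt_mul_sq_of_ordered {a b : ℝ} (hab : b ≤ a) (ha : a ≤ 1 / 2)
    (hb : 1 ≤ a + 4 * b) (hq : a * b ≤ 1 - a - b) :
    1 / 392 < a * b * (1 - a - b) ^ 2 := by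
  have hq5 : 1 / 25 ≤ a * b := by nlinarith
  have bound : ∀ Q T : ℝ, 0 ≤ T → 0 ≤ Q → 1 / 392 < Q * T ^ 2 → Q ≤ a * b → T ≤ 1 - a - b →
      1 / 392 < a * b * (1 - a - b) ^ 2 := by
    intro Q T hT hQ hlt h1 h2
    exact hlt.trans_le (by gcongr)
  rcases le_or_gt b (6 / 25) with h1 | h1
  · exact bound (1 / 25) (13 / 50) (by norm_num) (by norm_num) (by norm_num) hq5 (by linarith)
  rcases le_or_gt b (143 / 500) with h2 | h2
  · exact bound ((6 / 25) ^ 2) (107 / 500) (by norm_num) (by norm_num) (by norm_num) (by nlinarith)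
      (by linarith)
  rcases le_or_gt b (8 / 25) with h3 | h3
  · exact bound ((143 / 500) ^ 2) (9 / 50) (by norm_num) (by norm_num) (by norm_num)
      (by nlinarith) (by linarith)
  rcases le_or_gt (4 / 25) (1 - a - b) with h4 | h4
  · exact bound ((8 / 25) ^ 2) (4 / 25) (by norm_num) (by norm_num) (by norm_num)
      (by nlinarith) (by linarith)
  · nlinarith

/-- Under the product inequalities, an ordered partition `a ≥ b ≥ c ≥ d ≥ e > 0` of `1` satisfies
`a * b * c * d ≥ 1 / 3528`, and equality forces `(1/2, 1/3, 1/7, 1/84, 1/84)`. -/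
theorem inv_le_prod_of_ordered {a b c d e : ℝ} (hab : b ≤ a) (hbc : c ≤ b) (hcd : d ≤ c)
    (hde : e ≤ d) (he : 0 < e) (hsum : a + b + c + d + e = 1) (h1 : a ≤ b + c + d + e)
    (h2 : a * b ≤ c + d + e) (h3 : a * b * c ≤ d + e) :
    1 / 3528 ≤ a * b * c * d ∧ (a * b * c * d = 1 / 3528 →
      a = 1 / 2 ∧ b = 1 / 3 ∧ c = 1 / 7 ∧ d = 1 / 84) := by
  have hb : 0 < b := by linarith
  have ha : 0 < a := by linarith
  have hq : 0 < a * b := mul_pos ha hb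
  obtain ⟨t, ht⟩ : ∃ t, t = 1 - a - b := ⟨_, rfl⟩
  have hs : d + e = t - c := by linarith
  rw [hs] at h3
  have h2' : a * b ≤ t := by linarith
  have habc : 0 < a * b * c := mul_pos hq (by linarith)
  have hF : a * b * (c * (t - c)) ≤ 2 * (a * b * c * d) := by
    have := mul_le_mul_of_nonneg_left (show t - c ≤ 2 * d by linarith) habc.le
    linarith
  rcases le_or_gt c (t / 2) with hct | hct
  · have hlt := lt_mul_sq_of_ordered hab (by linarith) (by linarith) (ht ▸ h2')
    rw [← ht] at hlt
    have : 2 / 9 * t ^ 2 ≤ c * (t - c) := by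
      linarith [mul_nonneg (show 0 ≤ c - t / 3 by linarith) (show 0 ≤ 2 * t / 3 - c by linarith)]
    have : a * b * (2 / 9 * t ^ 2) ≤ a * b * (c * (t - c)) := by gcongr
    exact ⟨by linarith, fun he => by linarith⟩
  rcases lt_or_ge (b * (1 + a * b)) t with hbt | hbt
  · have hlt := lt_mul_of_third_eq_second hab (by linarith) (by linarith)
      (by rw [← ht]; linarith)
    rw [← ht] at hlt
    have : b * (t - b) ≤ c * (t - c) := by
      linarith [mul_nonneg (sub_nonneg.2 hbc) (show 0 ≤ b + c - t by linarith)]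
    have : a * b * (b * (t - b)) ≤ a * b * (c * (t - c)) := by gcongr
    exact ⟨by linarith, fun he => by linarith⟩
  · obtain ⟨hle, heq⟩ := one_add_mul_le_of_ordered hab hb (by linarith) (ht ▸ h2')
      (ht ▸ hbt)
    rw [← ht] at hle heq
    obtain ⟨u, hu⟩ : ∃ u, u * (1 + a * b) = t :=
      ⟨t / (1 + a * b), div_mul_cancel₀ _ (by positivity)⟩
    have hcu : c ≤ u := by
      refine le_of_mul_le_mul_right ?_ (show 0 < 1 + a * b by positivity)
      rw [hu]
      linarith
    have hg : u * (t - u) ≤ c * (t - c) := by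
      linarith [mul_nonneg (sub_nonneg.2 hcu) (show 0 ≤ u + c - t by linarith)]
    have hg' : a * b * (u * (t - u)) ≤ a * b * (c * (t - c)) := by gcongr
    have hu2 : a * b * (u * (t - u)) = (a * b * u) ^ 2 := by rw [← hu]; ring
    have hu42 : 1 / 42 ≤ a * b * u := by
      refine le_of_mul_le_mul_right ?_ (show 0 < 1 + a * b by positivity)
      rw [mul_assoc, hu]
      linarith
    have hsq : (1 / 42 : ℝ) ^ 2 ≤ (a * b * u) ^ 2 := by gcongr
    refine ⟨by linarith, fun hE => ?_⟩
    have e1 : a * b * u = 1 / 42 := by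
      refine le_antisymm (abs_le_of_sq_le_sq' ?_ (by norm_num)).2 hu42
      linarith
    obtain ⟨rfl, rfl⟩ := heq (by rw [← hu]; linear_combination (-42) * (1 + a * b) * e1)
    obtain rfl : u = 1 / 7 := by linarith
    obtain rfl : t = 1 / 6 := by linarith
    obtain rfl : c = 1 / 7 := by
      refine le_antisymm hcu (le_of_mul_le_mul_right ?_ (show 0 < c - 1 / 42 by linarith))
      linarith
    exact ⟨rfl, rfl, rfl, by linarith⟩

/-- The degree bound for weights sorted increasingly, with the description of the equality case. -/
theorem pow_four_le_prod_of_monotone {m : Fin 5 → ℕ} (hm : Monotone m) (hpos : ∀ i, 0 < m i)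
    {h : ℕ} (hh : ∑ i, m i = h)
    (hcan : ∀ κ : ℤ, 2 ≤ κ → κ ≤ (h : ℤ) - 2 → ∑ i, (m i : ℤ) * κ % h ≤ 3 * h) :
    h ^ 4 ≤ 3528 * ∏ i, m i ∧ (h ^ 4 = 3528 * ∏ i, m i → m = ![1, 1, 12, 28, 42]) := by
  have hh' : ∑ i, (m i : ℤ) = h := by exact_mod_cast hh
  have hprod := fun (s : Finset (Fin 5)) hs =>
    prod_div_le_sum_compl_div (w := fun i => (m i : ℤ)) (h := h) (s := s) (by simp)
      (fun i => by exact_mod_cast hpos i) hh' (by simpa using hcan) hs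
  have h1 := hprod {4} (by decide)
  have h2 := hprod {4, 3} (by decide)
  have h3 := hprod {4, 3, 2} (by decide)
  rw [show ({4} : Finset (Fin 5))ᶜ = {0, 1, 2, 3} by decide] at h1
  rw [show ({4, 3} : Finset (Fin 5))ᶜ = {0, 1, 2} by decide] at h2
  rw [show ({4, 3, 2} : Finset (Fin 5))ᶜ = {0, 1} by decide] at h3
  simp [-Finset.prod_div_distrib] at h1 h2 h3
  have h01 : m 0 ≤ m 1 := hm (by decide)
  have h12 : m 1 ≤ m 2 := hm (by decide)
  have h23 : m 2 ≤ m 3 := hm (by decide)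
  have h34 : m 3 ≤ m 4 := hm (by decide)
  have h0 := hpos 0
  have hpos1 : 0 < m 1 := h0.trans_le h01
  have hpos2 : 0 < m 2 := hpos1.trans_le h12
  have hpos3 : 0 < m 3 := hpos2.trans_le h23
  have hpos4 : 0 < m 4 := hpos3.trans_le h34
  rw [Fin.sum_univ_five] at hh
  have hhpos : (0 : ℝ) < h := by
    have : 0 < h := by omega
    exact_mod_cast this
  have hsum : (m 4 / h + m 3 / h + m 2 / h + m 1 / h + m 0 / h : ℝ) = 1 := by
    rw [← hh] at hhpos ⊢
    push_cast at hhpos ⊢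
    field_simp
    ring
  obtain ⟨hle, heq⟩ := inv_le_prod_of_ordered (a := m 4 / h) (b := m 3 / h) (c := m 2 / h)
    (d := m 1 / h) (e := m 0 / h) (by gcongr) (by gcongr) (by gcongr) (by gcongr)
    (by positivity) hsum (by linarith) (by linarith) (by linarith)
  have hP : (m 4 / h * (m 3 / h) * (m 2 / h) * (m 1 / h) : ℝ) =
      m 4 * m 3 * m 2 * m 1 / h ^ 4 := by field_simp
  rw [hP] at hle heq
  rw [div_le_div_iff₀ (by norm_num) (by positivity)] at hle
  rw [div_eq_div_iff (by positivity) (by norm_num)] at heq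
  have hle' : h ^ 4 ≤ 3528 * (m 4 * m 3 * m 2 * m 1) := by
    have : (h : ℝ) ^ 4 ≤ 3528 * (m 4 * m 3 * m 2 * m 1) := by linarith
    exact_mod_cast this
  have hall : ∏ i, m i = m 4 * m 3 * m 2 * m 1 * m 0 := by
    rw [Fin.prod_univ_five]
    ring
  have hp := Nat.le_mul_of_pos_right (m 4 * m 3 * m 2 * m 1) h0
  rw [hall]
  refine ⟨by omega, fun hE => ?_⟩
  have h4 : m 4 * m 3 * m 2 * m 1 = m 4 * m 3 * m 2 * m 1 * m 0 := by omega
  have h4' : m 0 = 1 := by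
    have hp0 : 0 < m 4 * m 3 * m 2 * m 1 := by positivity
    exact (Nat.eq_of_mul_eq_mul_left hp0 (by rw [← h4, mul_one])).symm
  obtain ⟨e4, e3, e2, e1⟩ := heq (by
    rw [h4', mul_one] at hE
    have : (h : ℝ) ^ 4 = 3528 * (m 4 * m 3 * m 2 * m 1) := by exact_mod_cast hE
    linarith)
  have e0 : (m 0 / h : ℝ) = 1 / 84 := by linarith
  have hh84 : (h : ℝ) = 84 := by
    rw [h4', div_eq_div_iff (by positivity) (by norm_num)] at e0
    push_cast at e0
    linarith
  rw [hh84, div_eq_iff (by norm_num)] at e1 e2 e3 e4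
  have r1 : (m 1 : ℝ) = (1 : ℕ) := by rw [e1]; norm_num
  have r2 : (m 2 : ℝ) = (12 : ℕ) := by rw [e2]; norm_num
  have r3 : (m 3 : ℝ) = (28 : ℕ) := by rw [e3]; norm_num
  have r4 : (m 4 : ℝ) = (42 : ℕ) := by rw [e4]; norm_num
  rw [Nat.cast_inj] at r1 r2 r3 r4
  funext i
  fin_cases i <;> simp [*]

/-- **Theorem 3.5(3).** For well-formed weights `(λ₀,…,λ₄)` with `gcd = 1` such that
`ℙ(λ₀,…,λ₄)` has at worst canonical singularities, the degree satisfies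
`h⁴/(λ₀λ₁λ₂λ₃λ₄) ≤ 3528`, with equality iff the weights are `(1, 1, 12, 28, 42)` up to
permutation. -/
theorem stmt_18 (lam : Fin 5 → ℕ)
    (hpos : ∀ i, 0 < lam i)
    (hgcd : Finset.univ.gcd lam = 1)
    (hwf : ∀ i : Fin 5, (Finset.univ.erase i).gcd lam = 1)
    (h : ℕ) (hh : h = ∑ i, lam i)
    (hcanon : ∀ κ : ℤ, 2 ≤ κ → κ ≤ (h : ℤ) - 2 →
      1 ≤ ∑ i, Int.fract ((lam i : ℚ) * (κ : ℚ) / (h : ℚ)) ∧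
        ∑ i, Int.fract ((lam i : ℚ) * (κ : ℚ) / (h : ℚ)) ≤ 3) :
    (h : ℚ) ^ 4 / (∏ i, (lam i : ℚ)) ≤ 3528 ∧
      ((h : ℚ) ^ 4 / (∏ i, (lam i : ℚ)) = 3528 ↔
        ∃ σ : Equiv.Perm (Fin 5),
          (fun i => lam (σ i)) = ![1, 1, 12, 28, 42]) := by
  let τ := Tuple.sort lam
  have hsum : ∑ i, (lam ∘ τ) i = h := by rw [hh]; exact Equiv.sum_comp τ lam
  have hprod : ∏ i, (lam ∘ τ) i = ∏ i, lam i := Equiv.prod_comp τ lam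
  have hhpos : 0 < h := hh ▸ Finset.sum_pos (fun i _ => hpos i) Finset.univ_nonempty
  have hhQ : (0 : ℚ) < h := by exact_mod_cast hhpos
  have hPQ : (0 : ℚ) < ∏ i, (lam i : ℚ) := Finset.prod_pos fun i _ => by exact_mod_cast hpos i
  obtain ⟨hle, heq⟩ := pow_four_le_prod_of_monotone (Tuple.monotone_sort lam)
    (fun i => hpos (τ i)) hsum (fun κ h2 hκ => by
      have hfract : ∀ i, Int.fract ((lam i : ℚ) * κ / h) = ((lam i : ℤ) * κ % h : ℤ) / h := by
        intro i
        have := Int.fract_div_intCast_eq_div_intCast_mod (k := ℚ) (m := (lam i : ℤ) * κ) (n := h)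
        push_cast at this
        exact_mod_cast this
      have h3 := (hcanon κ h2 hκ).2
      rw [Finset.sum_congr rfl fun i _ => hfract i, ← Finset.sum_div, div_le_iff₀ hhQ] at h3
      have h3' : ∑ i, (lam i : ℤ) * κ % h ≤ 3 * h := by exact_mod_cast h3
      rwa [← Equiv.sum_comp τ] at h3')
  rw [hprod] at hle heq
  refine ⟨?_, fun hE => ⟨τ, heq ?_⟩, ?_⟩
  · rw [div_le_iff₀ hPQ]
    exact_mod_cast hle
  · rw [div_eq_iff hPQ.ne'] at hE
    exact_mod_cast hE
  · rintro ⟨σ, hσ⟩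
    have hval : ∀ i, lam (σ i) = ![1, 1, 12, 28, 42] i := fun i => congrFun hσ i
    have h84 : h = 84 := by
      rw [hh, ← Equiv.sum_comp σ, Fin.sum_univ_five]
      simp [hval]
    rw [h84, ← Equiv.prod_comp σ, Fin.prod_univ_five]
    simp [hval]
    norm_num
end
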